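/- Let (Γ, ι) be a computable group with a canonically computable tempered two-sided Følner sequence (F_n)_{n≥1} such that |F_n|/log n → ∞. Let Λ be a finite alphabet, X ⊆ Λ^Γ a subshift, and μ an ergodic Γ-invariant Borel probability measure on X. Assume that the limit h := lim_{n→∞} H_μ(α_Λ^{F_n})/|F_n| exists (it does, and equals the Kolmogorov–Sinai entropy of (X, μ, Γ) since α_Λ is a generating partition). Then K̂(ω) ≥ h for μ-a.e. ω ∈ X, where K̂ denotes asymptotic Kolmogorov complexity along (F_n). -/

import Mathlib

open scoped Pointwise
open Filter Topology MeasureTheory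

/-- `(F n)` is a left Følner sequence. -/
def IsLeftFolner {Γ : Type*} [Group Γ] [DecidableEq Γ] (F : ℕ → Finset Γ) : Prop :=
  (∀ n, (F n).Nonempty) ∧
    ∀ K : Finset Γ,
      Tendsto (fun n => ((symmDiff (F n) (K * F n)).card : ℝ) / (F n).card) atTop (𝓝 0)

/-- `(F n)` is a right Følner sequence. -/
def IsRightFolner {Γ : Type*} [Group Γ] [DecidableEq Γ] (F : ℕ → Finset Γ) : Prop :=
  (∀ n, (F n).Nonempty) ∧
    ∀ K : Finset Γ,
      Tendsto (fun n => ((symmDiff (F n) (F n * K)).card : ℝ) / (F n).card) atTop (𝓝 0)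

/-- `(F n)` is tempered. -/
def IsTempered {Γ : Type*} [Group Γ] [DecidableEq Γ] (F : ℕ → Finset Γ) : Prop :=
  ∃ C : ℝ, ∀ j, (((Finset.range j).biUnion fun i => (F i)⁻¹ * F j).card : ℝ) ≤ C * (F j).card

/-- `(ι : Γ → ℕ)` is an admissible indexing. -/
def IsComputableGroup {Γ : Type*} [Group Γ] (ι : Γ → ℕ) : Prop :=
  Function.Injective ι ∧
    (∃ χ : ℕ → Bool, Computable χ ∧ ∀ m, χ m = true ↔ m ∈ Set.range ι) ∧
    ∃ m : ℕ → ℕ → ℕ, Computable₂ m ∧ ∀ a b : Γ, m (ι a) (ι b) = ι (a * b)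

/-- Canonically computable sequence of finite subsets. -/
def CanonicallyComputable {X : Type*} (ι : X → ℕ) (F : ℕ → Finset X) : Prop :=
  Computable fun n => ∑ x ∈ (F n).image ι, 2 ^ x

/-- Kolmogorov complexity of `w` w.r.t. the decompressor `A`. -/
noncomputable def KC {Λ : Type*} (A : List Bool →. List Λ) (w : List Λ) : ℕ :=
  sInf {l : ℕ | ∃ p : List Bool, p.length = l ∧ w ∈ A p}

/-- `A` is an optimal decompressor. -/
def IsOptimalDecompressor {Λ : Type*} [Primcodable Λ] (A : List Bool →. List Λ) : Prop :=
  Partrec A ∧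
    ∀ B : List Bool →. List Λ, Partrec B → ∃ c : ℕ,
      ∀ (w : List Λ) (p : List Bool), w ∈ B p →
        ∃ q : List Bool, w ∈ A q ∧ q.length ≤ p.length + c

/-- The `Λ`-string obtained by reading `ω` on `F` in the increasing order of `ι`. -/
noncomputable def wordString {X : Type*} [Nonempty X] {Λ : Type*}
    (ι : X → ℕ) (F : Finset X) (ω : X → Λ) : List Λ :=
  ((F.image ι).sort (· ≤ ·)).map fun m => ω (Function.invFun ι m)

/-- Asymptotic Kolmogorov complexity of `ω : Γ → Λ` along `(F n)`. -/
noncomputable def Khat {Γ : Type*} [Nonempty Γ] {Λ : Type*}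
    (A : List Bool →. List Λ) (ι : Γ → ℕ) (F : ℕ → Finset Γ) (ω : Γ → Λ) : ℝ :=
  limsup (fun n => (KC A (wordString ι (F n) ω) : ℝ) / (F n).card) atTop

/-- The shift action of `Γ` on `Λ^Γ`: `(g · ω)(x) = ω(x g)`. -/
def shiftAct {Γ : Type*} [Group Γ] {Λ : Type*} (g : Γ) (ω : Γ → Λ) : Γ → Λ :=
  fun x => ω (x * g)

/-- The Shannon entropy `H_μ(α_Λ^F)` of the partition of the subshift `X` into the
cylinders `{σ ∈ X : σ|_F = w}`, `w : F → Λ` (base-2 logarithm, `0 log 0 = 0`). -/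
noncomputable def cylinderEntropy {Γ : Type*} [DecidableEq Γ] {Λ : Type*} [Fintype Λ]
    [MeasurableSpace Λ] (μ : Measure (Γ → Λ)) (X : Set (Γ → Λ)) (F : Finset Γ) : ℝ :=
  ∑ w : (↥F → Λ),
    -((μ {σ | σ ∈ X ∧ ∀ g : ↥F, σ g = w g}).toReal *
      Real.logb 2 (μ {σ | σ ∈ X ∧ ∀ g : ↥F, σ g = w g}).toReal)

/-- Decodes a concatenation of blocks `1ᵏ0`, each block standing for the letter with code `k`. -/
def unaryDecode (Λ : Type*) [Primcodable Λ] (p : List Bool) : List Λ :=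
  (p.foldl (fun (s : List Λ × ℕ) b =>
    bif b then (s.1, s.2 + 1)
    else ((Encodable.decode (α := Λ) s.2).elim s.1 (fun a => a :: s.1), 0)) ([], 0)).1.reverse

lemma computable_unaryDecode (Λ : Type*) [Primcodable Λ] : Computable (unaryDecode Λ) := by
  refine Primrec.to_comp ?_
  refine Primrec.list_reverse.comp (Primrec.fst.comp (Primrec.list_foldl (f := fun p => p)
    (h := fun (_ : List Bool) (q : (List Λ × ℕ) × Bool) => bif q.2 then (q.1.1, q.1.2 + 1)
      else ((Encodable.decode (α := Λ) q.1.2).elim q.1.1 (fun a => a :: q.1.1), 0))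
    Primrec.id (Primrec.const _) ?_))
  have hs : Primrec fun q : List Bool × ((List Λ × ℕ) × Bool) => q.2.1 :=
    Primrec.fst.comp Primrec.snd
  refine Primrec.cond (Primrec.snd.comp Primrec.snd)
    (Primrec.pair (Primrec.fst.comp hs) (Primrec.succ.comp (Primrec.snd.comp hs)))
    (Primrec.pair ?_ (Primrec.const 0))
  refine (Primrec.option_casesOn (Primrec.decode.comp (Primrec.snd.comp hs))
    (Primrec.fst.comp hs) (g := fun q a => a :: q.2.1.1)
    (Primrec.list_cons.comp Primrec.snd
      ((Primrec.fst.comp hs).comp Primrec.fst)).to₂).of_eq fun q => ?_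
  cases (Encodable.decode (α := Λ) q.2.1.2) <;> rfl

lemma unaryDecode_flatMap {Λ : Type*} [Primcodable Λ] (w : List Λ) :
    unaryDecode Λ (w.flatMap fun a => List.replicate (Encodable.encode a) true ++ [false]) = w := by
  have block (k : ℕ) (s : List Λ × ℕ) :
      (List.replicate k true).foldl (fun (s : List Λ × ℕ) b =>
        bif b then (s.1, s.2 + 1)
        else ((Encodable.decode (α := Λ) s.2).elim s.1 (fun a => a :: s.1), 0)) s
        = (s.1, s.2 + k) := by
    induction k generalizing s with
    | zero => simp
    | succ k ih =>
      rw [List.replicate_succ, List.foldl_cons, ih]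
      simp [Nat.add_comm, Nat.add_left_comm]
  have main (acc : List Λ) :
      (w.flatMap fun a => List.replicate (Encodable.encode a) true ++ [false]).foldl
        (fun (s : List Λ × ℕ) b => bif b then (s.1, s.2 + 1)
        else ((Encodable.decode (α := Λ) s.2).elim s.1 (fun a => a :: s.1), 0)) (acc, 0)
        = (w.reverse ++ acc, 0) := by
    induction w generalizing acc with
    | nil => simp
    | cons a w ih =>
      rw [List.flatMap_cons, List.foldl_append, List.foldl_append, block]
      simp only [Nat.zero_add, List.foldl_cons, List.foldl_nil, cond_false,
        Encodable.encodek, Option.elim_some]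
      rw [ih]
      simp
  simp [unaryDecode, main]

/-- Over a finite alphabet, an optimal decompressor produces every word from a program of at most
linear length. -/
lemma IsOptimalDecompressor.exists_program {Λ : Type*} [Fintype Λ] [Primcodable Λ]
    {A : List Bool →. List Λ} (hA : IsOptimalDecompressor A) :
    ∃ C : ℕ, ∀ w : List Λ, ∃ q, w ∈ A q ∧ q.length ≤ C * w.length + C := by
  obtain ⟨c, hc⟩ := hA.2 _ (computable_unaryDecode Λ).partrec
  let M := ∑ a : Λ, (Encodable.encode a + 1)
  refine ⟨M + c, fun w => ?_⟩
  obtain ⟨q, hq, hlen⟩ := hc w _ (by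
    simpa using (unaryDecode_flatMap w).symm)
  refine ⟨q, hq, hlen.trans ?_⟩
  have hw : (w.flatMap fun a => List.replicate (Encodable.encode a) true ++ [false]).length
      ≤ M * w.length := by
    clear hlen hq
    induction w with
    | nil => simp
    | cons a w ih =>
      have ha : Encodable.encode a + 1 ≤ M :=
        Finset.single_le_sum (f := fun a : Λ => Encodable.encode a + 1)
          (fun _ _ => Nat.zero_le _) (Finset.mem_univ a)
      rw [List.flatMap_cons, List.length_append, List.length_cons, Nat.mul_succ]
      simp only [List.length_append, List.length_replicate, List.length_singleton] at *
      omega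
  nlinarith [Nat.zero_le (c * w.length)]

lemma IsOptimalDecompressor.exists_mem {Λ : Type*} [Fintype Λ] [Primcodable Λ]
    {A : List Bool →. List Λ} (hA : IsOptimalDecompressor A) (w : List Λ) :
    ∃ p : List Bool, p.length = KC A w ∧ w ∈ A p := by
  obtain ⟨C, hC⟩ := hA.exists_program
  obtain ⟨q, hq, -⟩ := hC w
  exact Nat.sInf_mem (s := {l : ℕ | ∃ p : List Bool, p.length = l ∧ w ∈ A p}) ⟨_, q, rfl, hq⟩

lemma IsOptimalDecompressor.exists_KC_le {Λ : Type*} [Fintype Λ] [Primcodable Λ]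
    {A : List Bool →. List Λ} (hA : IsOptimalDecompressor A) :
    ∃ C : ℕ, ∀ w : List Λ, KC A w ≤ C * w.length + C := by
  obtain ⟨C, hC⟩ := hA.exists_program
  refine ⟨C, fun w => ?_⟩
  obtain ⟨q, hq, hlen⟩ := hC w
  exact (Nat.sInf_le (s := {l : ℕ | ∃ p : List Bool, p.length = l ∧ w ∈ A p})
    ⟨q, rfl, hq⟩).trans hlen

lemma card_boolList_length_le (m : ℕ) :
    {p : List Bool | p.length ≤ m}.Finite ∧ {p : List Bool | p.length ≤ m}.ncard ≤ 2 ^ (m + 1) := by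
  have hsub : {p : List Bool | p.length ≤ m} ⊆
      ((Finset.range (m + 1)).biUnion fun k =>
        (Finset.univ : Finset (List.Vector Bool k)).image List.Vector.toList : Finset (List Bool)) := by
    intro p hp
    have hp' : p.length < m + 1 := Nat.lt_succ_of_le hp
    exact Finset.mem_coe.2 (Finset.mem_biUnion.2 ⟨p.length, Finset.mem_range.2 hp',
      Finset.mem_image.2 ⟨⟨p, rfl⟩, Finset.mem_univ _, rfl⟩⟩)
  refine ⟨(Finset.finite_toSet _).subset hsub, ?_⟩
  refine (Set.ncard_le_ncard hsub (Finset.finite_toSet _)).trans ?_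
  rw [Set.ncard_coe_finset]
  refine Finset.card_biUnion_le.trans ?_
  refine (Finset.sum_le_sum (g := fun k => 2 ^ k) fun k _ => ?_).trans ?_
  · refine Finset.card_image_le.trans ?_
    rw [Finset.card_univ, card_vector, Fintype.card_bool]
  · exact (Nat.geomSum_lt le_rfl (by simp)).le

/-- There are few words of small complexity. -/
lemma IsOptimalDecompressor.ncard_KC_lt {Λ : Type*} [Fintype Λ] [Primcodable Λ]
    {A : List Bool →. List Λ} (hA : IsOptimalDecompressor A) (s : ℝ) :
    {w | (KC A w : ℝ) < s}.Finite ∧ ({w | (KC A w : ℝ) < s}.ncard : ℝ) ≤ 2 ^ (s + 1) := by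
  rcases lt_or_ge s 0 with hs | hs
  · have : {w | (KC A w : ℝ) < s} = ∅ := by
      ext w
      simpa using hs.le.trans (Nat.cast_nonneg _)
    rw [this]
    simpa using by positivity
  choose P hP using hA.exists_mem
  obtain ⟨hfin, hcard⟩ := card_boolList_length_le ⌊s⌋₊
  have hmaps : ∀ w ∈ {w | (KC A w : ℝ) < s}, P w ∈ {p : List Bool | p.length ≤ ⌊s⌋₊} := by
    intro w hw
    simp only [Set.mem_ofPred_eq, (hP w).1]
    exact Nat.le_floor (le_of_lt hw)
  have hinj : Set.InjOn P {w | (KC A w : ℝ) < s} := by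
    intro w _ w' _ hww
    exact Part.mem_unique (hP w).2 (hww ▸ (hP w').2)
  refine ⟨Set.Finite.of_finite_image (hfin.subset (Set.image_subset_iff.2 hmaps)) hinj, ?_⟩
  calc ({w | (KC A w : ℝ) < s}.ncard : ℝ) ≤ ((2 ^ (⌊s⌋₊ + 1) : ℕ) : ℝ) := by
        exact_mod_cast (Set.ncard_le_ncard_of_injOn P hmaps hinj hfin).trans hcard
    _ = (2 : ℝ) ^ ((⌊s⌋₊ : ℝ) + 1) := by
        rw [← Nat.cast_add_one, Real.rpow_natCast]; push_cast; rfl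
    _ ≤ 2 ^ (s + 1) := by
        gcongr
        · norm_num
        · exact Nat.floor_le hs

lemma length_wordString {X : Type*} [Nonempty X] {Λ : Type*} {ι : X → ℕ}
    (hι : Function.Injective ι) (F : Finset X) (ω : X → Λ) :
    (wordString ι F ω).length = F.card := by
  simp [wordString, Finset.card_image_of_injective F hι]

lemma wordString_eq_iff {X : Type*} [Nonempty X] {Λ : Type*} {ι : X → ℕ}
    (hι : Function.Injective ι) {F : Finset X} {ω ω' : X → Λ} :
    wordString ι F ω = wordString ι F ω' ↔ ∀ x ∈ F, ω x = ω' x := by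
  simp [wordString, List.map_inj_left, Function.leftInverse_invFun hι _]

/-- If a map is determined by a pair of maps, its image has at most as many points as the pair
has values. -/
lemma Set.ncard_image_le_mul {α β γ δ : Type*} [Fintype δ] (S : Set α) (f : α → β) (a : α → γ)
    (b : α → δ) (T : Set γ) (hT : T.Finite) (haT : ∀ x ∈ S, a x ∈ T)
    (hdet : ∀ x ∈ S, ∀ y ∈ S, a x = a y → b x = b y → f x = f y) :
    (f '' S).ncard ≤ T.ncard * Fintype.card δ := by
  rcases S.eq_empty_or_nonempty with rfl | ⟨x₀, -⟩
  · simp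
  have : Nonempty α := ⟨x₀⟩
  have hex : ∀ y ∈ f '' S, ∃ x ∈ S, f x = y := fun y hy => hy
  choose! g hgS hg using hex
  have hfin : (T ×ˢ (Set.univ : Set δ)).Finite := hT.prod Set.finite_univ
  have := Set.ncard_le_ncard_of_injOn (s := f '' S) (t := T ×ˢ (Set.univ : Set δ))
    (fun y => (a (g y), b (g y))) (fun y hy => ⟨haT _ (hgS y hy), trivial⟩)
    (fun y hy z hz h => by
      rw [Prod.mk.injEq] at h
      rw [← hg y hy, ← hg z hz]
      exact hdet _ (hgS y hy) _ (hgS z hz) h.1 h.2) hfin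
  rwa [Set.ncard_prod, Set.ncard_univ, Nat.card_eq_fintype_card] at this

/-- Entropy bound for a probability vector which is mostly concentrated on `W`. -/
lemma sum_negMulLog_le_of_concentrated {β : Type*} [Fintype β] [DecidableEq β] {p : β → ℝ}
    (hp : ∀ w, 0 ≤ p w) (hsum : ∑ w, p w = 1) (W : Finset β) {δ : ℝ}
    (hW : ∑ w ∈ Wᶜ, p w ≤ δ) :
    ∑ w, Real.negMulLog (p w) ≤ Real.log W.card + δ * Real.log (Fintype.card β) + 1 := by
  have key (x : ℝ) (hx : 0 ≤ x) (N : ℝ) (hN : 0 < N) :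
      Real.negMulLog x ≤ x * Real.log N + (1 / N - x) := by
    rcases hx.eq_or_lt with rfl | hx
    · simpa using hN.le
    have h1 := Real.log_le_sub_one_of_pos (x := 1 / (N * x)) (by positivity)
    rw [one_div, Real.log_inv, Real.log_mul hN.ne' hx.ne'] at h1
    have h2 := mul_le_mul_of_nonneg_left h1 hx.le
    have h3 : x * ((N * x)⁻¹ - 1) = 1 / N - x := by field_simp
    rw [h3] at h2
    rw [Real.negMulLog]
    linarith
  have part (V : Finset β) (N : ℝ) (hVN : V.card ≤ N) :
      ∑ w ∈ V, Real.negMulLog (p w) ≤ (∑ w ∈ V, p w) * Real.log N + (1 - ∑ w ∈ V, p w) := by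
    rcases V.eq_empty_or_nonempty with rfl | hV
    · simp
    have hN : 0 < N := lt_of_lt_of_le (by exact_mod_cast hV.card_pos) hVN
    refine (Finset.sum_le_sum fun w _ => key (p w) (hp w) N hN).trans ?_
    rw [Finset.sum_add_distrib, ← Finset.sum_mul, Finset.sum_sub_distrib, Finset.sum_const,
      nsmul_eq_mul]
    have : (V.card : ℝ) * (1 / N) ≤ 1 := by
      rw [mul_one_div]; exact div_le_one_of_le₀ hVN hN.le
    linarith
  have hsplit : ∑ w ∈ W, p w + ∑ w ∈ Wᶜ, p w = 1 := by rw [Finset.sum_add_sum_compl, hsum]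
  have hc : 0 ≤ ∑ w ∈ Wᶜ, p w := Finset.sum_nonneg fun w _ => hp w
  have h1 := part W W.card le_rfl
  have h2 := part Wᶜ (Fintype.card β) (by exact_mod_cast Finset.card_le_univ _)
  have h3 : (∑ w ∈ W, p w) * Real.log W.card ≤ Real.log W.card :=
    mul_le_of_le_one_left (Real.log_natCast_nonneg _) (by linarith)
  have h4 := mul_le_mul_of_nonneg_right hW (Real.log_natCast_nonneg (Fintype.card β))
  rw [← Finset.sum_add_sum_compl W]
  linarith

/-- A set depending on finitely many coordinates is measurable. -/
lemma measurableSet_of_finite_support {Γ Λ : Type*} [Finite Λ] [MeasurableSpace Λ]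
    [MeasurableSingletonClass Λ] (F : Finset Γ) (D : Set (Γ → Λ))
    (hD : ∀ ω ω' : Γ → Λ, (∀ x ∈ F, ω x = ω' x) → ω ∈ D → ω' ∈ D) : MeasurableSet D := by
  have : D = F.restrict ⁻¹' (F.restrict (π := fun _ => Λ) '' D) := by
    refine (Set.subset_preimage_image _ _).antisymm ?_
    rintro ω' ⟨ω, hω, h⟩
    exact hD ω ω' (fun x hx => congrFun h ⟨x, hx⟩) hω
  rw [this]
  exact Finset.measurable_restrict F (Set.toFinite _).measurableSet

lemma cylinderEntropy_mul_log_two {Γ : Type*} [DecidableEq Γ] {Λ : Type*} [Fintype Λ]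
    [MeasurableSpace Λ] (μ : Measure (Γ → Λ)) {X : Set (Γ → Λ)} (hX : ∀ᵐ ω ∂μ, ω ∈ X)
    (F : Finset Γ) :
    cylinderEntropy μ X F * Real.log 2
      = ∑ w : F → Λ, Real.negMulLog (μ.real (F.restrict ⁻¹' {w})) := by
  have hμ (w : F → Λ) : μ {σ | σ ∈ X ∧ ∀ g : F, σ g = w g} = μ (F.restrict ⁻¹' {w}) := by
    refine measure_congr ?_
    filter_upwards [hX] with ω hω
    refine propext ⟨fun h => funext h.2, fun h => ⟨hω, fun g => congrFun h g⟩⟩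
  have h2 : Real.log 2 ≠ 0 := (Real.log_pos (by norm_num)).ne'
  rw [cylinderEntropy, Finset.sum_mul]
  refine Finset.sum_congr rfl fun w _ => ?_
  rw [hμ, Real.negMulLog, Real.logb, Measure.real]
  field_simp

/-- If `S` has almost full measure and few restrictions to `F`, the entropy along `F` is small. -/
lemma cylinderEntropy_mul_log_two_le {Γ : Type*} [DecidableEq Γ] {Λ : Type*} [Fintype Λ]
    [MeasurableSpace Λ] [MeasurableSingletonClass Λ] (μ : Measure (Γ → Λ))
    [IsProbabilityMeasure μ] {X : Set (Γ → Λ)} (hX : ∀ᵐ ω ∂μ, ω ∈ X) (F : Finset Γ)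
    {S : Set (Γ → Λ)} {δ : ℝ} (hS : 1 - δ ≤ μ.real S) :
    cylinderEntropy μ X F * Real.log 2
      ≤ Real.log (F.restrict (π := fun _ => Λ) '' S).ncard
        + δ * (F.card * Real.log (Fintype.card Λ)) + 1 := by
  classical
  rw [cylinderEntropy_mul_log_two μ hX]
  have hfin : (F.restrict (π := fun _ => Λ) '' S).Finite := Set.toFinite _
  have hm (w : F → Λ) : MeasurableSet (F.restrict (π := fun _ => Λ) ⁻¹' {w}) :=
    Finset.measurable_restrict F (measurableSet_singleton w)
  have hsum (V : Finset (F → Λ)) :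
      ∑ w ∈ V, μ.real (F.restrict ⁻¹' {w}) = μ.real (F.restrict ⁻¹' (V : Set (F → Λ))) := by
    rw [← measureReal_biUnion_finset]
    · congr 1
      ext ω
      simp
    · intro v _ w _ hvw
      exact Disjoint.preimage _ (by simpa using hvw)
    · exact fun w _ => hm w
  have hV (V : Finset (F → Λ)) :
      MeasurableSet (F.restrict (π := fun _ => Λ) ⁻¹' (V : Set (F → Λ))) :=
    Finset.measurable_restrict F V.finite_toSet.measurableSet
  have := sum_negMulLog_le_of_concentrated (p := fun w : F → Λ => μ.real (F.restrict ⁻¹' {w}))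
    (fun _ => measureReal_nonneg) (by rw [hsum]; simp) hfin.toFinset (δ := δ) (by
      rw [hsum, Finset.coe_compl, Set.preimage_compl, probReal_compl_eq_one_sub (hV _)]
      have : μ.real S ≤ μ.real (F.restrict ⁻¹' (hfin.toFinset : Set (F → Λ))) := by
        refine measureReal_mono ?_
        rw [Set.Finite.coe_toFinset]
        exact Set.subset_preimage_image _ _
      linarith)
  rw [Set.ncard_eq_toFinset_card _ hfin]
  simpa using this

lemma shiftAct_shiftAct {Γ : Type*} [Group Γ] {Λ : Type*} (g k : Γ) (ω : Γ → Λ) :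
    shiftAct g (shiftAct k ω) = shiftAct (g * k) ω := by
  funext x
  simp [shiftAct, mul_assoc]

/-- Few words on `F` come from configurations one of whose translates by `g` has low complexity
on `F`. -/
lemma ncard_restrict_translate_le {Γ : Type*} [Group Γ] [DecidableEq Γ] {Λ : Type*} [Fintype Λ]
    [Nonempty Λ] [Primcodable Λ] {A : List Bool →. List Λ} (hA : IsOptimalDecompressor A)
    {ι : Γ → ℕ} (hι : Function.Injective ι) (F : Finset Γ) (g : Γ) (s : ℝ) :
    ((F.restrict (π := fun _ => Λ) ''
      {ω | (KC A (wordString ι F (shiftAct g ω)) : ℝ) < s}).ncard : ℝ)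
      ≤ 2 ^ (s + 1) * (Fintype.card Λ : ℝ) ^ (symmDiff F (F * {g})).card := by
  obtain ⟨hfin, hcard⟩ := hA.ncard_KC_lt s
  have h1 := Set.ncard_image_le_mul {ω | (KC A (wordString ι F (shiftAct g ω)) : ℝ) < s}
    (F.restrict (π := fun _ => Λ)) (fun ω => wordString ι F (shiftAct g ω))
    ((symmDiff F (F * {g})).restrict (π := fun _ => Λ)) _ hfin (fun ω hω => hω) (by
      intro ω _ ω' _ hw hr
      funext ⟨x, hx⟩
      by_cases hxg : x ∈ F * {g}
      · obtain ⟨y, hy, rfl⟩ : ∃ y ∈ F, y * g = x := by simpa [Finset.mem_mul] using hxg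
        exact (wordString_eq_iff hι).1 hw y hy
      · exact congrFun hr ⟨x, Finset.mem_symmDiff.2 (Or.inl ⟨hx, hxg⟩)⟩)
  calc _ ≤ ((_ * Fintype.card (↥(symmDiff F (F * {g})) → Λ) : ℕ) : ℝ) := by exact_mod_cast h1
    _ ≤ _ := by
      rw [Nat.cast_mul, Fintype.card_fun, Fintype.card_coe, Nat.cast_pow]
      gcongr

lemma log_ncard_restrict_le {Γ : Type*} [Group Γ] [DecidableEq Γ] {Λ : Type*} [Fintype Λ]
    [Nonempty Λ] [Primcodable Λ] {A : List Bool →. List Λ} (hA : IsOptimalDecompressor A)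
    {ι : Γ → ℕ} (hι : Function.Injective ι) (F : Finset Γ) {κ : Type*} {T : Finset κ} (e : κ → Γ)
    {s : ℝ} {S : Set (Γ → Λ)} (hS : S.Nonempty)
    (hsub : S ⊆ ⋃ i ∈ T, {ω | (KC A (wordString ι F (shiftAct (e i) ω)) : ℝ) < s}) :
    Real.log (F.restrict (π := fun _ => Λ) '' S).ncard
      ≤ Real.log T.card + (s + 1) * Real.log 2
        + ((∑ i ∈ T, (symmDiff F (F * {e i})).card : ℕ) : ℝ) * Real.log (Fintype.card Λ) := by
  have hL1 : (1 : ℝ) ≤ Fintype.card Λ := by exact_mod_cast Fintype.card_pos (α := Λ)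
  set m := ∑ i ∈ T, (symmDiff F (F * {e i})).card with hm
  have hle : ((F.restrict (π := fun _ => Λ) '' S).ncard : ℝ)
      ≤ T.card * (2 ^ (s + 1) * (Fintype.card Λ : ℝ) ^ m) := by
    have himage : F.restrict (π := fun _ => Λ) '' S ⊆ ⋃ i ∈ T, F.restrict (π := fun _ => Λ) ''
        {ω | (KC A (wordString ι F (shiftAct (e i) ω)) : ℝ) < s} := by
      simpa only [Set.image_iUnion] using Set.image_mono (f := F.restrict (π := fun _ => Λ)) hsub
    have hcard := (Set.ncard_le_ncard himage (Set.toFinite _)).trans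
      (Finset.set_ncard_biUnion_le _ _)
    refine (Nat.cast_le (α := ℝ).2 hcard).trans ?_
    rw [Nat.cast_sum, ← nsmul_eq_mul]
    refine Finset.sum_le_card_nsmul _ _ _ fun i hi => ?_
    refine (ncard_restrict_translate_le hA hι F (e i) s).trans ?_
    gcongr
    exact Finset.single_le_sum (f := fun i => (symmDiff F (F * {e i})).card)
        (fun _ _ => Nat.zero_le _) hi
  have hcpos : (0 : ℝ) < (F.restrict (π := fun _ => Λ) '' S).ncard := by
    exact_mod_cast (Set.ncard_pos (Set.toFinite _)).2 (hS.image _)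
  have hT : (T.card : ℝ) ≠ 0 := by
    intro h0
    rw [h0, zero_mul] at hle
    linarith
  refine (Real.log_le_log hcpos hle).trans_eq ?_
  rw [Real.log_mul hT (by positivity), Real.log_mul (by positivity)
    (by positivity), Real.log_rpow (by norm_num), Real.log_pow]
  ring

/-- If almost all configurations have a translate, out of finitely many, with complexity rate
below `r`, then the entropy rate is at most about `r`. -/
lemma entropy_rate_mul_log_two_le {Γ : Type*} [Group Γ] [DecidableEq Γ] {Λ : Type*} [Fintype Λ]
    [Nonempty Λ] [Primcodable Λ] [MeasurableSpace Λ] [MeasurableSingletonClass Λ]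
    {A : List Bool →. List Λ} (hA : IsOptimalDecompressor A)
    {ι : Γ → ℕ} (hι : Function.Injective ι) {F : ℕ → Finset Γ} (hFr : IsRightFolner F)
    (hFtop : Tendsto (fun n => ((F n).card : ℝ)) atTop atTop) (μ : Measure (Γ → Λ))
    [IsProbabilityMeasure μ] {X : Set (Γ → Λ)} (hX : ∀ᵐ ω ∂μ, ω ∈ X) {h : ℝ}
    (hent : Tendsto (fun n => cylinderEntropy μ X (F n) / (F n).card) atTop (𝓝 h))
    {κ : Type*} {T : Finset κ} (e : κ → Γ) {r δ : ℝ} {S : Set (Γ → Λ)} (hS : S.Nonempty)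
    (hμS : 1 - δ ≤ μ.real S)
    (hsub : ∀ᶠ n in atTop, S ⊆ ⋃ i ∈ T,
      {ω | (KC A (wordString ι (F n) (shiftAct (e i) ω)) : ℝ) < r * (F n).card}) :
    h * Real.log 2 ≤ r * Real.log 2 + δ * Real.log (Fintype.card Λ) := by
  let s (n : ℕ) : ℕ := ∑ i ∈ T, (symmDiff (F n) (F n * {e i})).card
  have hs : Tendsto (fun n => (s n : ℝ) / (F n).card) atTop (𝓝 0) := by
    have := tendsto_finsetSum T fun i _ => hFr.2 {e i}
    simpa [s, Finset.sum_div] using this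
  have hlim : Tendsto (fun n => (Real.log T.card + Real.log 2 + 1) / ((F n).card : ℝ)
      + (s n : ℝ) / (F n).card * Real.log (Fintype.card Λ)
      + (r * Real.log 2 + δ * Real.log (Fintype.card Λ))) atTop
      (𝓝 (0 + 0 * Real.log (Fintype.card Λ)
        + (r * Real.log 2 + δ * Real.log (Fintype.card Λ)))) :=
    ((hFtop.const_div_atTop _).add (hs.mul_const _)).add_const _
  rw [zero_mul, zero_add, zero_add] at hlim
  refine le_of_tendsto_of_tendsto (hent.mul_const _) hlim ?_
  filter_upwards [hsub] with n hn
  have h1 := cylinderEntropy_mul_log_two_le μ hX (F n) hμS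
  have h2 : _ ≤ _ + (s n : ℝ) * _ := log_ncard_restrict_le hA hι (F n) e hS hn
  have hc : (0 : ℝ) < (F n).card := by exact_mod_cast (hFr.1 n).card_pos
  rw [div_mul_eq_mul_div, div_le_iff₀ hc]
  have h3 : ((Real.log T.card + Real.log 2 + 1) / ((F n).card : ℝ)
      + (s n : ℝ) / (F n).card * Real.log (Fintype.card Λ)
      + (r * Real.log 2 + δ * Real.log (Fintype.card Λ))) * (F n).card
      = Real.log T.card + Real.log 2 + 1 + s n * Real.log (Fintype.card Λ)
        + (r * Real.log 2 + δ * Real.log (Fintype.card Λ)) * (F n).card := by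
    field_simp
  rw [h3]
  linarith

lemma IsOptimalDecompressor.eventually_KC_lt_of_Khat_lt {Γ : Type*} [Nonempty Γ]
    {Λ : Type*} [Fintype Λ] [Primcodable Λ] {A : List Bool →. List Λ}
    (hA : IsOptimalDecompressor A) {ι : Γ → ℕ} (hι : Function.Injective ι) {F : ℕ → Finset Γ}
    (hF : ∀ n, (F n).Nonempty) {ω : Γ → Λ} {r : ℝ} (h : Khat A ι F ω < r) :
    ∀ᶠ n in atTop, (KC A (wordString ι (F n) ω) : ℝ) < r * (F n).card := by
  obtain ⟨C, hC⟩ := hA.exists_KC_le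
  have hpos (n : ℕ) : (1 : ℝ) ≤ (F n).card := by exact_mod_cast (hF n).card_pos
  have hb : IsBoundedUnder (· ≤ ·) atTop
      fun n => (KC A (wordString ι (F n) ω) : ℝ) / (F n).card := by
    refine isBoundedUnder_of ⟨C + C, fun n => ?_⟩
    rw [div_le_iff₀ (by linarith [hpos n])]
    have h1 : (KC A (wordString ι (F n) ω) : ℝ) ≤ C * (F n).card + C := by
      have := hC (wordString ι (F n) ω)
      rw [length_wordString hι] at this
      exact_mod_cast this
    nlinarith [hpos n, Nat.cast_nonneg (α := ℝ) C]
  filter_upwards [eventually_lt_of_limsup_lt h hb] with n hn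
  rwa [div_lt_iff₀ (by linarith [hpos n])] at hn

theorem stmt9 {Γ : Type*} [Group Γ] [Countable Γ] [Infinite Γ] [DecidableEq Γ]
    {Λ : Type*} [Fintype Λ] [Primcodable Λ] [TopologicalSpace Λ] [DiscreteTopology Λ]
    [MeasurableSpace Λ] [MeasurableSingletonClass Λ]
    (ι : Γ → ℕ) (hcg : IsComputableGroup ι)
    (F : ℕ → Finset Γ)
    (hFl : IsLeftFolner F) (hFr : IsRightFolner F) (htemp : IsTempered F)
    (hcc : CanonicallyComputable ι F)
    (hgrowth : Tendsto (fun n => ((F n).card : ℝ) / Real.log n) atTop atTop)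
    (A : List Bool →. List Λ) (hA : IsOptimalDecompressor A)
    (X : Set (Γ → Λ)) (hXne : X.Nonempty) (hXcl : IsClosed X)
    (hXinv : ∀ (g : Γ), ∀ ω ∈ X, shiftAct g ω ∈ X)
    (μ : Measure (Γ → Λ)) [IsProbabilityMeasure μ] (hμX : μ X = 1)
    (hμinv : ∀ g : Γ, MeasurePreserving (shiftAct g) μ μ)
    (herg : ∀ E : Set (Γ → Λ), MeasurableSet E → (∀ g : Γ, shiftAct g ⁻¹' E = E) →
      μ E = 0 ∨ μ E = 1)
    (h : ℝ)
    (hent : Tendsto (fun n => cylinderEntropy μ X (F n) / (F n).card) atTop (𝓝 h)) :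
    ∀ᵐ ω ∂μ, h ≤ Khat A ι F ω := by
  have hι := hcg.1
  have hne := hFl.1
  have hXae : ∀ᵐ ω ∂μ, ω ∈ X := by
    rw [← prob_compl_eq_zero_iff hXcl.measurableSet] at hμX
    exact hμX
  obtain ⟨ω₀, -⟩ := hXne
  have : Nonempty Λ := ⟨ω₀ 1⟩
  have hlog2 : 0 < Real.log 2 := Real.log_pos (by norm_num)
  have hFtop : Tendsto (fun n => ((F n).card : ℝ)) atTop atTop := by
    have hlog := Real.tendsto_log_atTop.comp (tendsto_natCast_atTop_atTop (R := ℝ))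
    refine (hgrowth.atTop_mul_atTop₀ hlog).congr' ?_
    filter_upwards [hlog.eventually_gt_atTop 0] with n hn
    exact div_mul_cancel₀ _ (ne_of_gt hn)
  let D (r : ℝ) (n : ℕ) : Set (Γ → Λ) := {ω | (KC A (wordString ι (F n) ω) : ℝ) < r * (F n).card}
  have hDm (r : ℝ) (n : ℕ) : MeasurableSet (D r n) := by
    refine measurableSet_of_finite_support (F n) _ fun ω ω' hω h => ?_
    have := (wordString_eq_iff hι).2 hω
    simpa only [D, Set.mem_ofPred_eq, this] using h
  suffices hnull : ∀ r < h, μ {ω | ∀ᶠ n in atTop, ω ∈ D r n} = 0 by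
    have hq : ∀ᵐ ω ∂μ, ∀ q : ℚ, (q : ℝ) < h → ¬ ∀ᶠ n in atTop, ω ∈ D q n := by
      rw [ae_all_iff]
      intro q
      by_cases hq : (q : ℝ) < h
      · filter_upwards [measure_eq_zero_iff_ae_notMem.1 (hnull q hq)] with ω hω _ using hω
      · exact Eventually.of_forall fun _ h => absurd h hq
    filter_upwards [hq] with ω hω
    by_contra! hlt
    obtain ⟨q, hq1, hq2⟩ := exists_rat_btwn hlt
    exact hω q hq2 (hA.eventually_KC_lt_of_Khat_lt hι hne hq1)
  intro r hr
  by_contra hpos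
  let S (k : ℕ) : Set (Γ → Λ) := ⋂ n ≥ k, D r n
  have hSm (k : ℕ) : MeasurableSet (S k) :=
    MeasurableSet.iInter fun n => MeasurableSet.iInter fun _ => hDm r n
  obtain ⟨e, he⟩ := exists_surjective_nat Γ
  let U (k : ℕ) : Set (Γ → Λ) := ⋃ i ≤ k, shiftAct (e i) ⁻¹' S k
  have hUm (k : ℕ) : MeasurableSet (U k) :=
    MeasurableSet.iUnion fun i => MeasurableSet.iUnion fun _ => (hμinv _).measurable (hSm k)
  have hmemU (ω : Γ → Λ) :
      ω ∈ ⋃ k, U k ↔ ∃ g : Γ, ∀ᶠ n in atTop, shiftAct g ω ∈ D r n := by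
    simp only [U, S, Set.mem_iUnion, Set.mem_preimage, Set.mem_iInter, eventually_atTop]
    constructor
    · rintro ⟨k, i, -, hi⟩
      exact ⟨e i, k, hi⟩
    · rintro ⟨g, k, hk⟩
      obtain ⟨i, rfl⟩ := he g
      exact ⟨max k i, i, le_max_right _ _, fun n hn => hk n ((le_max_left _ _).trans hn)⟩
  have hUmono : Monotone U := by
    intro k l hkl ω hω
    simp only [U, S, Set.mem_iUnion, Set.mem_preimage, Set.mem_iInter] at hω ⊢
    obtain ⟨i, hi, h⟩ := hω
    exact ⟨i, hi.trans hkl, fun n hn => h n (hkl.trans hn)⟩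
  have hUone : μ (⋃ k, U k) = 1 := by
    refine (herg _ (MeasurableSet.iUnion hUm) fun g => ?_).resolve_left fun h0 => hpos ?_
    · ext ω
      rw [Set.mem_preimage, hmemU, hmemU]
      simp only [shiftAct_shiftAct]
      exact ⟨fun ⟨k, hk⟩ => ⟨k * g, hk⟩, fun ⟨k, hk⟩ => ⟨k * g⁻¹, by simpa using hk⟩⟩
    · refine measure_mono_null (fun ω hω => ?_) h0
      refine (hmemU ω).2 ⟨1, ?_⟩
      have : shiftAct 1 ω = ω := by funext x; simp [shiftAct]
      rwa [this]
  have hUlim : Tendsto (fun k => μ.real (U k)) atTop (𝓝 1) := by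
    have h1 := tendsto_measure_iUnion_atTop (μ := μ) hUmono
    rw [hUone] at h1
    exact (ENNReal.tendsto_toReal ENNReal.one_ne_top).comp h1
  have hbound : ∀ δ : ℝ, 0 < δ → δ < 1 →
      h * Real.log 2 ≤ r * Real.log 2 + δ * Real.log (Fintype.card Λ) := by
    intro δ hδ hδ1
    obtain ⟨k, hk⟩ := (hUlim.eventually (lt_mem_nhds (by linarith : 1 - δ < 1))).exists
    have hUne : (U k).Nonempty := by
      by_contra hempty
      rw [Set.not_nonempty_iff_eq_empty] at hempty
      rw [hempty, measureReal_empty] at hk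
      linarith
    refine entropy_rate_mul_log_two_le hA hι hFr hFtop μ hXae hent (T := Finset.range (k + 1)) e
      hUne hk.le ?_
    filter_upwards [eventually_ge_atTop k] with n hn ω hω
    simp only [U, S, Set.mem_iUnion, Set.mem_preimage, Set.mem_iInter] at hω
    obtain ⟨i, hi, h⟩ := hω
    have hiT : i ∈ Finset.range (k + 1) := Finset.mem_range.2 (by omega)
    have hmem : (KC A (wordString ι (F n) (shiftAct (e i) ω)) : ℝ) < r * (F n).card := h n hn
    simp only [Set.mem_iUnion]
    exact ⟨i, hiT, hmem⟩
  have hlim0 : Tendsto (fun δ : ℝ => r * Real.log 2 + δ * Real.log (Fintype.card Λ)) (𝓝[>] 0)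
      (𝓝 (r * Real.log 2 + 0 * Real.log (Fintype.card Λ))) :=
    ((continuous_const.add (continuous_id.mul continuous_const)).tendsto 0).mono_left
      nhdsWithin_le_nhds
  have hfinal := ge_of_tendsto hlim0 (by
    filter_upwards [Ioo_mem_nhdsGT (zero_lt_one (α := ℝ))] with δ hδ
    exact hbound δ hδ.1 hδ.2)
  rw [zero_mul, add_zero] at hfinal
  exact absurd (le_of_mul_le_mul_right hfinal hlog2) (not_le.2 hr)
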